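/- For every A ∈ ℂ and every z ∈ ℂ ∖ S, the function Φ_e(·;A) satisfies the third-order linear ODE Φ_e'''(z;A) − 4 q(z;A) Φ_e'(z;A) − 2 q'(z;A) Φ_e(z;A) = 0 (derivatives taken in z). -/

import Mathlib

open Complex Filter Topology

noncomputable section

/-- The lattice `Λ_τ = ℤ + τℤ`. -/
def Lam (τ : ℂ) : Set ℂ := {ω | ∃ m n : ℤ, ω = (m : ℂ) + (n : ℂ) * τ}

/-- The nonzero lattice points. -/
def Lam' (τ : ℂ) : Set ℂ := {ω | ω ∈ Lam τ ∧ ω ≠ 0}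

/-- The Weierstrass elliptic function `℘(z; τ)`. -/
def wp (τ z : ℂ) : ℂ :=
  1 / z ^ 2 + ∑' ω : Lam' τ, (1 / (z - (ω : ℂ)) ^ 2 - 1 / (ω : ℂ) ^ 2)

/-- The Weierstrass zeta function `ζ(z; τ)`. -/
def wzeta (τ z : ℂ) : ℂ :=
  1 / z + ∑' ω : Lam' τ, (1 / (z - (ω : ℂ)) + 1 / (ω : ℂ) + z / (ω : ℂ) ^ 2)

/-- The Weierstrass sigma function `σ(z; τ)`. -/
def wsigma (τ z : ℂ) : ℂ :=
  z * ∏' ω : Lam' τ,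
    ((1 - z / (ω : ℂ)) * Complex.exp (z / (ω : ℂ) + z ^ 2 / (2 * (ω : ℂ) ^ 2)))

/-- `℘'(z; τ)`. -/
def wpd (τ : ℂ) : ℂ → ℂ := deriv (wp τ)

/-- `℘''(z; τ)`. -/
def wpdd (τ : ℂ) : ℂ → ℂ := deriv (deriv (wp τ))

/-- The constant `B(A)`. -/
def Bc (τ p A : ℂ) : ℂ :=
  A ^ 2 - wzeta τ (2 * p) * A - 3 / 4 * wp τ (2 * p) - 2 * wp τ p

/-- The potential `q(z; A)`. -/
def qpot (τ p A z : ℂ) : ℂ :=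
  2 * wp τ z + 3 / 4 * (wp τ (z + p) + wp τ (z - p))
    + A * (wzeta τ (z + p) - wzeta τ (z - p)) + Bc τ p A

/-- The singular set `S = Λ_τ ∪ (p + Λ_τ) ∪ (−p + Λ_τ)`. -/
def Sset (τ p : ℂ) : Set ℂ :=
  Lam τ ∪ {z | z - p ∈ Lam τ} ∪ {z | z + p ∈ Lam τ}

/-- The unique elliptic solution `Φ_e(z; A)` of the second symmetric product equation. -/
def Phie (τ p A z : ℂ) : ℂ :=
  wp τ z + (A / 2 - 3 * wpdd τ p / (8 * wpd τ p)) * (wzeta τ (z + p) - wzeta τ (z - p))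
    - A ^ 2 + (wpdd τ p / (2 * wpd τ p) - wzeta τ p) * A
    - wp τ p + 3 / 4 * (wpdd τ p / wpd τ p) * wzeta τ p
    + 3 / 16 * (wpdd τ p ^ 2 / wpd τ p ^ 2)

/-- The cubic factor `Y₁(A)`. -/
def Y1 (τ p A : ℂ) : ℂ :=
  A ^ 3 - 5 * wpdd τ p / (4 * wpd τ p) * A ^ 2
    + 3 * (wp τ p + wpdd τ p ^ 2 / (16 * wpd τ p ^ 2)) * A
    + wpd τ p / 2 - 9 * wpdd τ p / (4 * wpd τ p) * wp τ p
    + 9 / 64 * (wpdd τ p ^ 3 / wpd τ p ^ 3)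

/-- The cubic factor `Y₂(A)`. -/
def Y2 (τ p A : ℂ) : ℂ :=
  A ^ 3 - wpdd τ p / (4 * wpd τ p) * A ^ 2
    - 5 / 16 * (wpdd τ p ^ 2 / wpd τ p ^ 2) * A
    + 2 * wpd τ p - 3 / 64 * (wpdd τ p ^ 3 / wpd τ p ^ 3)

namespace PeriodPair

variable (L : PeriodPair)

/-- The Weierstrass `ζ` function of a lattice with its pole `1 / z` at the origin removed. -/
def zetaRegular (z : ℂ) : ℂ :=
  ∑' l : L.lattice, if l.1 = 0 then 0 else (1 / (z - l) + 1 / l + z / l ^ 2)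

/-- The Weierstrass `ζ` function of a lattice. -/
def weierstrassZeta (z : ℂ) : ℂ := 1 / z + L.zetaRegular z

lemma weierstrassZeta_bound (r : ℝ) (hr : 0 < r) (s : ℂ) (hs : ‖s‖ < r) (l : ℂ)
    (h : 2 * r ≤ ‖l‖) :
    ‖1 / (s - l) + 1 / l + s / l ^ 2‖ ≤ 2 * r ^ 2 * ‖l‖ ^ (-3 : ℝ) := by
  have hl : 0 < ‖l‖ := by linarith
  have hl0 : l ≠ 0 := norm_pos_iff.mp hl
  have hsl : ‖l‖ / 2 ≤ ‖s - l‖ := by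
    rw [norm_sub_rev]
    exact .trans (by linarith) (norm_sub_norm_le l s)
  have hsl0 : s - l ≠ 0 := norm_pos_iff.mp (by linarith)
  calc
    _ = ‖s ^ 2 / ((s - l) * l ^ 2)‖ := by
      congr 1
      field_simp
      ring
    _ = ‖s‖ ^ 2 / (‖s - l‖ * ‖l‖ ^ 2) := by simp
    _ ≤ r ^ 2 / (‖l‖ / 2 * ‖l‖ ^ 2) := by gcongr
    _ = 2 * r ^ 2 / ‖l‖ ^ 3 := by field
    _ = _ := by norm_cast

lemma hasSumLocallyUniformly_zetaRegular :
    HasSumLocallyUniformly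
      (fun (l : L.lattice) (z : ℂ) ↦ if l.1 = 0 then 0 else (1 / (z - l) + 1 / l + z / l ^ 2))
      L.zetaRegular := by
  refine L.hasSumLocallyUniformly_aux (u := fun r l ↦ 2 * r ^ 2 * ‖l‖ ^ (-3 : ℝ)) _
    (fun _ _ ↦ (ZLattice.summable_norm_rpow _ _ (by simp; norm_num)).mul_left _) fun r hr ↦
    Filter.eventually_atTop.mpr ⟨2 * r, ?_⟩
  rintro _ h s hs l rfl
  split_ifs
  · rw [norm_zero]
    positivity
  · exact weierstrassZeta_bound r hr s hs l h

lemma hasDerivAt_zetaRegular_summand {z : ℂ} (hz : z ∈ ((L.lattice : Set ℂ) \ {0})ᶜ)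
    (l : L.lattice) :
    HasDerivAt (fun z : ℂ ↦ if l.1 = 0 then 0 else (1 / (z - l) + 1 / l + z / (l : ℂ) ^ 2))
      (-(if l.1 = 0 then 0 else (1 / (z - l) ^ 2 - 1 / (l : ℂ) ^ 2))) z := by
  split_ifs with hl
  · simpa using hasDerivAt_const z (0 : ℂ)
  · have hzl : z - l ≠ 0 := fun e ↦ hl (by
      obtain rfl := sub_eq_zero.mp e
      simpa using hz)
    have h := ((((hasDerivAt_id z).sub_const (l : ℂ)).inv hzl).add_const (1 / (l : ℂ))).add
      ((hasDerivAt_id z).div_const ((l : ℂ) ^ 2))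
    convert! h using 1
    · ext w
      simp
    · simp [neg_div]
      ring

lemma differentiableOn_zetaRegular :
    DifferentiableOn ℂ L.zetaRegular ((L.lattice : Set ℂ) \ {0})ᶜ :=
  L.hasSumLocallyUniformly_zetaRegular.hasSumLocallyUniformlyOn.differentiableOn
    (.of_forall fun _ ↦ .fun_sum fun i _ _ hz ↦
      (L.hasDerivAt_zetaRegular_summand hz i).differentiableAt.differentiableWithinAt)
    L.isOpen_compl_lattice_sdiff

lemma hasDerivAt_zetaRegular {z : ℂ} (hz : z ∈ ((L.lattice : Set ℂ) \ {0})ᶜ) :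
    HasDerivAt L.zetaRegular (-℘[L - (0 : ℂ)] z) z := by
  have key : Set.EqOn (deriv L.zetaRegular) (fun z ↦ -℘[L - (0 : ℂ)] z)
      ((L.lattice : Set ℂ) \ {0})ᶜ := by
    refine (L.hasSumLocallyUniformly_zetaRegular.tendstoLocallyUniformlyOn.deriv
      (.of_forall fun _ ↦ .fun_sum fun i _ _ hz ↦
        (L.hasDerivAt_zetaRegular_summand hz i).differentiableAt.differentiableWithinAt)
      L.isOpen_compl_lattice_sdiff).unique ?_
    have h := (L.hasSumLocallyUniformly_weierstrassPExcept 0).tendstoLocallyUniformlyOn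
      (s := ((L.lattice : Set ℂ) \ {0})ᶜ)
    have h' := h.fun_neg
    refine h'.congr ?_
    intro s w hw
    simp only [Function.comp_apply]
    rw [(HasDerivAt.fun_sum fun i _ ↦ L.hasDerivAt_zetaRegular_summand hw i).deriv,
      Finset.sum_neg_distrib]
  have hk := key hz
  simp only at hk
  rw [← hk]
  exact (L.differentiableOn_zetaRegular.differentiableAt
    (L.isOpen_compl_lattice_sdiff.mem_nhds hz)).hasDerivAt

@[simp]
lemma zetaRegular_zero : L.zetaRegular 0 = 0 := by
  have (l : L.lattice) : (if l.1 = 0 then 0 else (1 / (0 - l) + 1 / l + 0 / (l : ℂ) ^ 2)) = 0 := by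
    split_ifs
    · rfl
    · simp
  simp only [zetaRegular, this, tsum_zero]

lemma zetaRegular_neg (z : ℂ) : L.zetaRegular (-z) = -L.zetaRegular z := by
  simp only [zetaRegular]
  rw [← (Equiv.neg L.lattice).tsum_eq, ← tsum_neg]
  congr! 2 with l
  by_cases hl : l.1 = 0
  · simp [hl]
  · have h : -z + (l : ℂ) = -(z - l) := by ring
    simp only [Equiv.neg_apply, NegMemClass.coe_neg, neg_eq_zero, hl, if_false, sub_neg_eq_add, h,
      one_div, inv_neg]
    ring

@[simp]
lemma weierstrassZeta_neg (z : ℂ) : L.weierstrassZeta (-z) = -L.weierstrassZeta z := by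
  simp only [weierstrassZeta, zetaRegular_neg]
  ring

lemma hasDerivAt_weierstrassZeta {z : ℂ} (hz : z ∉ L.lattice) :
    HasDerivAt L.weierstrassZeta (-℘[L] z) z := by
  have hz0 : z ≠ 0 := by
    rintro rfl
    simp at hz
  have h := (hasDerivAt_inv hz0).add (L.hasDerivAt_zetaRegular (z := z) (by simp [hz]))
  have h0 := L.weierstrassPExcept_add 0 z
  simp only [ZeroMemClass.coe_zero, sub_zero] at h0
  convert! h using 1
  · ext w
    simp [weierstrassZeta]
  · rw [← h0]
    simp

lemma notMem_add_lattice {z : ℂ} (hz : z ∉ L.lattice) (l : L.lattice) : z + l ∉ L.lattice :=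
  fun h ↦ hz (by simpa using sub_mem h l.2)

lemma countable_lattice : (L.lattice : Set ℂ).Countable :=
  have : Countable L.lattice := L.latticeEquivProd.toEquiv.countable_iff.mpr inferInstance
  Set.to_countable (L.lattice : Set ℂ)

lemma isPreconnected_compl_lattice : IsPreconnected (L.lattice : Set ℂ)ᶜ :=
  (L.countable_lattice.isConnected_compl_of_one_lt_rank (by simp)).2

lemma exists_weierstrassZeta_add_coe (l : L.lattice) :
    ∃ η : ℂ, ∀ z ∉ L.lattice, L.weierstrassZeta (z + l) = L.weierstrassZeta z + η := by
  have hd {z : ℂ} (hz : z ∉ L.lattice) :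
      HasDerivAt (fun z ↦ L.weierstrassZeta (z + l) - L.weierstrassZeta z) 0 z := by
    have h := ((L.hasDerivAt_weierstrassZeta (L.notMem_add_lattice hz l)).comp_add_const z
      (l : ℂ)).sub (L.hasDerivAt_weierstrassZeta hz)
    simpa using! h
  obtain ⟨η, hη⟩ := L.isClosed_lattice.isOpen_compl.exists_is_const_of_deriv_eq_zero
    L.isPreconnected_compl_lattice
    (f := fun z ↦ L.weierstrassZeta (z + l) - L.weierstrassZeta z)
    (fun z hz ↦ (hd hz).differentiableAt.differentiableWithinAt) (fun z hz ↦ (hd hz).deriv)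
  refine ⟨η, fun z hz ↦ ?_⟩
  rw [← hη z hz]
  ring

lemma tendsto_div_sq_of_deriv_eq_zero {f f' : ℂ → ℂ} {c : ℂ}
    (hf : ∀ᶠ z in 𝓝 0, HasDerivAt f (f' z) z) (hf' : HasDerivAt f' c 0)
    (h0 : f 0 = 0) (h1 : f' 0 = 0) :
    Tendsto (fun z ↦ f z / z ^ 2) (𝓝[≠] 0) (𝓝 (c / 2)) := by
  have hfa : AnalyticAt ℂ f 0 :=
    Complex.analyticAt_iff_eventually_differentiableAt.mpr (hf.mono fun _ h ↦ h.differentiableAt)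
  have hd : deriv f =ᶠ[𝓝 0] f' := hf.mono fun _ h ↦ h.deriv
  have hd2 : deriv (deriv f) 0 = c := hd.deriv_eq.trans hf'.deriv
  obtain ⟨g, hg, hfg⟩ := (natCast_le_analyticOrderAt hfa (n := 2)).mp
    ((natCast_le_analyticOrderAt_iff_iteratedDeriv_eq_zero hfa).mpr fun i hi ↦ by
      interval_cases i
      · simpa using h0
      · simpa [hd.eq_of_nhds] using h1)
  simp only [sub_zero, smul_eq_mul] at hfg
  have hg' : ∀ᶠ z in 𝓝 0, deriv f z = 2 * z * g z + z ^ 2 * deriv g z := by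
    filter_upwards [hfg.eventually_nhds, hg.eventually_analyticAt] with z hz hgz
    rw [EventuallyEq.deriv_eq hz]
    simpa using! ((hasDerivAt_pow 2 z).mul hgz.differentiableAt.hasDerivAt).deriv
  have hc : c = 2 * g 0 := by
    have h := (((hasDerivAt_id (0 : ℂ)).const_mul 2).mul hg.differentiableAt.hasDerivAt).add
      ((hasDerivAt_pow 2 (0 : ℂ)).mul hg.deriv.differentiableAt.hasDerivAt)
    rw [← hd2, EventuallyEq.deriv_eq hg']
    simpa using! h.deriv
  have hlim : Tendsto g (𝓝[≠] 0) (𝓝 (c / 2)) := by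
    rw [hc, mul_div_cancel_left₀ _ two_ne_zero]
    exact hg.continuousAt.tendsto.mono_left nhdsWithin_le_nhds
  refine hlim.congr' ?_
  filter_upwards [nhdsWithin_le_nhds hfg, self_mem_nhdsWithin] with z hz hz0
  rw [hz, mul_div_cancel_left₀ _ (pow_ne_zero 2 hz0)]

lemma hasDerivAt_weierstrassP {z : ℂ} (hz : z ∉ L.lattice) :
    HasDerivAt ℘[L] (℘'[L] z) z := by
  rw [← L.deriv_weierstrassP]
  exact (L.analyticOnNhd_weierstrassP z hz).differentiableAt.hasDerivAt

lemma hasDerivAt_derivWeierstrassP {z : ℂ} (hz : z ∉ L.lattice) :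
    HasDerivAt ℘'[L] (deriv ℘'[L] z) z :=
  (L.analyticOnNhd_derivWeierstrassP z hz).differentiableAt.hasDerivAt

lemma eventually_add_notMem_lattice {z c : ℂ} (hz : z + c ∉ L.lattice) :
    ∀ᶠ w in 𝓝 z, w + c ∉ L.lattice :=
  (continuous_add_const c).continuousAt.eventually
    (L.isClosed_lattice.isOpen_compl.mem_nhds hz)

lemma eventually_sub_notMem_lattice {z c : ℂ} (hz : z - c ∉ L.lattice) :
    ∀ᶠ w in 𝓝 z, w - c ∉ L.lattice := by
  simpa [sub_eq_add_neg] using L.eventually_add_notMem_lattice (c := -c) (z := z)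
    (by simpa [sub_eq_add_neg] using hz)

lemma eventually_punctured_notMem_lattice (z : ℂ) : ∀ᶠ w in 𝓝[≠] z, w ∉ L.lattice := by
  filter_upwards [nhdsWithin_le_nhds (L.compl_lattice_sdiff_singleton_mem_nhds z),
    self_mem_nhdsWithin] with w hw hwz hwL
  exact hw ⟨hwL, hwz⟩

lemma eventually_punctured_add_notMem_lattice (z c : ℂ) :
    ∀ᶠ w in 𝓝[≠] z, w + c ∉ L.lattice := by
  refine Tendsto.eventually (f := (· + c)) ?_ (L.eventually_punctured_notMem_lattice (z + c))
  refine tendsto_nhdsWithin_of_tendsto_nhds_of_eventually_within _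
    ((continuous_add_const c).tendsto z |>.mono_left nhdsWithin_le_nhds) ?_
  filter_upwards [self_mem_nhdsWithin] with w hw
  simpa using hw

/-- `z`, `z - p` and `z + p` are not lattice points. -/
def IsRegularFor (p z : ℂ) : Prop := z ∉ L.lattice ∧ z - p ∉ L.lattice ∧ z + p ∉ L.lattice

variable {L} in
lemma IsRegularFor.eventually {p z : ℂ} (h : L.IsRegularFor p z) :
    ∀ᶠ w in 𝓝 z, L.IsRegularFor p w := by
  filter_upwards [L.isClosed_lattice.isOpen_compl.mem_nhds h.1,
    L.eventually_sub_notMem_lattice h.2.1, L.eventually_add_notMem_lattice h.2.2] with w h1 h2 h3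
  exact ⟨h1, h2, h3⟩

lemma eventually_punctured_isRegularFor (p z : ℂ) : ∀ᶠ w in 𝓝[≠] z, L.IsRegularFor p w := by
  filter_upwards [L.eventually_punctured_notMem_lattice z,
    L.eventually_punctured_add_notMem_lattice z (-p),
    L.eventually_punctured_add_notMem_lattice z p] with w h1 h2 h3
  exact ⟨h1, by simpa [sub_eq_add_neg] using h2, h3⟩

lemma isRegularFor_add_coe (p z : ℂ) (l : L.lattice) :
    L.IsRegularFor p (z + l) ↔ L.IsRegularFor p z := by
  have h (c : ℂ) : c + l ∈ L.lattice ↔ c ∈ L.lattice :=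
    L.lattice.toAddSubgroup.add_mem_cancel_right l.2
  rw [IsRegularFor, IsRegularFor, h, add_sub_right_comm, h, add_right_comm, h]

/-- The defect of the addition formula for `ζ`, cleared of denominators. -/
def additionDefect (p z : ℂ) : ℂ :=
  (L.weierstrassZeta (z + p) - L.weierstrassZeta (z - p) - 2 * L.weierstrassZeta p) *
    (℘[L] z - ℘[L] p) + ℘'[L] p

lemma additionDefect_neg (p z : ℂ) : L.additionDefect p (-z) = L.additionDefect p z := by
  rw [additionDefect, additionDefect, ← neg_add', weierstrassZeta_neg,
    show -z + p = -(z - p) by ring, weierstrassZeta_neg, weierstrassP_neg]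
  ring

lemma additionDefect_add_coe {p z : ℂ} (hz : L.IsRegularFor p z) (l : L.lattice) :
    L.additionDefect p (z + l) = L.additionDefect p z := by
  obtain ⟨η, hη⟩ := L.exists_weierstrassZeta_add_coe l
  rw [additionDefect, additionDefect, add_right_comm, hη _ hz.2.2, add_sub_right_comm z,
    hη _ hz.2.1, weierstrassP_add_coe]
  ring

lemma analyticAt_additionDefect {p z : ℂ} (hz : L.IsRegularFor p z) :
    AnalyticAt ℂ (L.additionDefect p) z := by
  refine Complex.analyticAt_iff_eventually_differentiableAt.mpr (hz.eventually.mono ?_)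
  intro w hw
  have h1 := (L.hasDerivAt_weierstrassZeta hw.2.2).comp_add_const w p
  have h2 := (L.hasDerivAt_weierstrassZeta hw.2.1).comp_sub_const w p
  have h3 := L.hasDerivAt_weierstrassP hw.1
  exact ((((h1.sub h2).sub_const _).mul (h3.sub_const _)).add_const _).differentiableAt

lemma tendsto_additionDefect_zero {p : ℂ} (hp : p ∉ L.lattice) :
    Tendsto (L.additionDefect p) (𝓝[≠] 0) (𝓝 0) := by
  have hp' : -p ∉ L.lattice := by rwa [neg_mem_iff]
  have hT : Tendsto (fun z ↦ (L.weierstrassZeta (z + p) - L.weierstrassZeta (z - p)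
      - 2 * L.weierstrassZeta p) / z ^ 2) (𝓝[≠] 0) (𝓝 ((-℘'[L] p + ℘'[L] (-p)) / 2)) := by
    refine tendsto_div_sq_of_deriv_eq_zero (f' := fun z ↦ -℘[L] (z + p) + ℘[L] (z - p)) ?_ ?_ ?_ ?_
    · filter_upwards [L.eventually_add_notMem_lattice (z := 0) (c := p) (by simpa using hp),
        L.eventually_sub_notMem_lattice (z := 0) (c := p) (by simpa using hp)] with z h1 h2
      have h := (((L.hasDerivAt_weierstrassZeta h1).comp_add_const z p).sub
        ((L.hasDerivAt_weierstrassZeta h2).comp_sub_const z p)).sub_const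
          (2 * L.weierstrassZeta p)
      simpa using! h
    · have h1 : HasDerivAt ℘[L] (℘'[L] p) (0 + p) := by
        simpa using L.hasDerivAt_weierstrassP hp
      have h2 : HasDerivAt ℘[L] (℘'[L] (-p)) (0 - p) := by
        simpa using L.hasDerivAt_weierstrassP hp'
      exact (h1.comp_add_const 0 p).neg.add (h2.comp_sub_const 0 p)
    · simp
      ring
    · simp
  have hP : Tendsto (fun z ↦ 1 + z ^ 2 * (℘[L - (0 : ℂ)] z - ℘[L] p)) (𝓝[≠] 0) (𝓝 1) := by
    have hc : ContinuousAt (fun z ↦ 1 + z ^ 2 * (℘[L - (0 : ℂ)] z - ℘[L] p)) 0 := by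
      have := (L.analyticAt_weierstrassPExcept 0).continuousAt
      fun_prop
    simpa using hc.tendsto.mono_left nhdsWithin_le_nhds
  have h := (hT.mul hP).add_const (℘'[L] p)
  simp only [derivWeierstrassP_neg, mul_one] at h
  rw [show (-℘'[L] p + -℘'[L] p) / 2 + ℘'[L] p = 0 by ring] at h
  refine h.congr' ?_
  filter_upwards [self_mem_nhdsWithin] with z hz
  have h0 := L.weierstrassPExcept_add 0 z
  have hz : z ≠ 0 := hz
  simp only [ZeroMemClass.coe_zero, sub_zero, ne_eq, OfNat.ofNat_ne_zero, not_false_eq_true,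
    zero_pow, div_zero] at h0
  rw [additionDefect, ← h0]
  field_simp
  ring

lemma tendsto_additionDefect_self {p : ℂ} (hp : p ∉ L.lattice) (h2p : 2 * p ∉ L.lattice) :
    Tendsto (L.additionDefect p) (𝓝[≠] p) (𝓝 0) := by
  have hs : Tendsto (fun z ↦ (℘[L] z - ℘[L] p) / (z - p)) (𝓝[≠] p) (𝓝 (℘'[L] p)) := by
    refine (hasDerivAt_iff_tendsto_slope.mp (L.hasDerivAt_weierstrassP hp)).congr fun z ↦ ?_
    rw [slope_def_field]
  have hc : ContinuousAt (fun z ↦ (L.weierstrassZeta (z + p) - L.zetaRegular (z - p)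
      - 2 * L.weierstrassZeta p) * (℘[L] z - ℘[L] p)) p := by
    have h1 : HasDerivAt L.weierstrassZeta _ (p + p) :=
      L.hasDerivAt_weierstrassZeta (by simpa [two_mul] using h2p)
    have h2 : HasDerivAt L.zetaRegular _ (p - p) :=
      L.hasDerivAt_zetaRegular (by simp)
    exact ((((h1.comp_add_const p p).sub (h2.comp_sub_const p p)).sub_const _).mul
      ((L.hasDerivAt_weierstrassP hp).sub_const _)).continuousAt
  have hc' := hc.tendsto.mono_left (nhdsWithin_le_nhds (s := {p}ᶜ))
  have h := (hc'.sub hs).add_const (℘'[L] p)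
  simp only [sub_self, mul_zero, zero_sub, neg_add_cancel] at h
  refine h.congr fun z ↦ ?_
  simp only [additionDefect]
  rw [weierstrassZeta.eq_def L (z - p)]
  ring

lemma tendsto_additionDefect_neg {p : ℂ} (hp : p ∉ L.lattice) (h2p : 2 * p ∉ L.lattice) :
    Tendsto (L.additionDefect p) (𝓝[≠] (-p)) (𝓝 0) := by
  have hn : Tendsto (fun z : ℂ ↦ -z) (𝓝[≠] (-p)) (𝓝[≠] p) := by
    refine tendsto_nhdsWithin_of_tendsto_nhds_of_eventually_within _ ?_ ?_
    · simpa using (continuous_neg.tendsto (-p)).mono_left nhdsWithin_le_nhds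
    · filter_upwards [self_mem_nhdsWithin] with w hw h
      exact hw (by simp [← Set.mem_singleton_iff.mp h])
  refine ((L.tendsto_additionDefect_self hp h2p).comp hn).congr fun z ↦ ?_
  simp [additionDefect_neg]

lemma tendsto_additionDefect_add_coe {p z : ℂ} (l : L.lattice)
    (h : Tendsto (L.additionDefect p) (𝓝[≠] z) (𝓝 0)) :
    Tendsto (L.additionDefect p) (𝓝[≠] (z + l)) (𝓝 0) := by
  have hn : Tendsto (fun w : ℂ ↦ w - l) (𝓝[≠] (z + l)) (𝓝[≠] z) := by
    refine tendsto_nhdsWithin_of_tendsto_nhds_of_eventually_within _ ?_ ?_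
    · simpa using ((continuous_sub_right (l : ℂ)).tendsto (z + l)).mono_left nhdsWithin_le_nhds
    · filter_upwards [self_mem_nhdsWithin] with w hw h
      exact hw (by simp [← Set.mem_singleton_iff.mp h])
  refine (h.comp hn).congr' ?_
  filter_upwards [hn.eventually (L.eventually_punctured_isRegularFor p z)] with w hw
  rw [Function.comp_apply, ← L.additionDefect_add_coe hw l, sub_add_cancel]

lemma tendsto_additionDefect_of_not_isRegularFor {p z : ℂ} (hp : p ∉ L.lattice)
    (h2p : 2 * p ∉ L.lattice) (hz : ¬ L.IsRegularFor p z) :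
    Tendsto (L.additionDefect p) (𝓝[≠] z) (𝓝 0) := by
  simp only [IsRegularFor, not_and_or, not_not] at hz
  rcases hz with hz | hz | hz
  · simpa using L.tendsto_additionDefect_add_coe ⟨z, hz⟩ (L.tendsto_additionDefect_zero hp)
  · simpa using L.tendsto_additionDefect_add_coe ⟨z - p, hz⟩
      (L.tendsto_additionDefect_self hp h2p)
  · simpa using L.tendsto_additionDefect_add_coe ⟨z + p, hz⟩
      (L.tendsto_additionDefect_neg hp h2p)

lemma additionDefect_eq_zero {p z : ℂ} (hp : p ∉ L.lattice) (h2p : 2 * p ∉ L.lattice)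
    (hz : L.IsRegularFor p z) : L.additionDefect p z = 0 := by
  classical
  let F : ℂ → ℂ := fun z ↦ if L.IsRegularFor p z then L.additionDefect p z else 0
  have hF {w : ℂ} (hw : L.IsRegularFor p w) : F w = L.additionDefect p w := if_pos hw
  have hdiff {w : ℂ} (hw : L.IsRegularFor p w) : DifferentiableAt ℂ F w :=
    (L.analyticAt_additionDefect hw).differentiableAt.congr_of_eventuallyEq
      (hw.eventually.mono fun _ h ↦ hF h)
  have hd : Differentiable ℂ F := by
    intro w
    by_cases hw : L.IsRegularFor p w
    · exact hdiff hw
    · have hev := L.eventually_punctured_isRegularFor p w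
      refine (analyticAt_of_differentiable_on_punctured_nhds_of_continuousAt
        (hev.mono fun _ ↦ hdiff) ?_).differentiableAt
      rw [continuousAt_iff_punctured_nhds, show F w = 0 from if_neg hw]
      exact (L.tendsto_additionDefect_of_not_isRegularFor hp h2p hw).congr'
        (hev.mono fun _ h ↦ (hF h).symm)
  have hper : ∀ z w, w ∈ L.lattice → F (z + w) = F z := by
    intro z w hw
    lift w to L.lattice using hw
    by_cases hz : L.IsRegularFor p z
    · rw [hF hz, hF ((L.isRegularFor_add_coe p z w).mpr hz), L.additionDefect_add_coe hz]
    · rw [show F z = 0 from if_neg hz,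
        show F (z + w) = 0 from if_neg fun h ↦ hz ((L.isRegularFor_add_coe p z w).mp h)]
  have hconst := hd.apply_eq_apply_of_bounded
    (IsZLattice.isCompact_range_of_periodic L.lattice F hd.continuous hper).isBounded z 0
  rw [← hF hz, hconst]
  exact if_neg fun h ↦ h.1 (zero_mem _)

lemma notMem_of_two_mul_notMem {p : ℂ} (h2p : 2 * p ∉ L.lattice) : p ∉ L.lattice :=
  fun h ↦ h2p (by rw [two_mul]; exact add_mem h h)

/-- `℘'` does not vanish outside the half-period lattice. -/
lemma derivWeierstrassP_ne_zero {p : ℂ} (h2p : 2 * p ∉ L.lattice) : ℘'[L] p ≠ 0 := by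
  intro hb
  have hp := L.notMem_of_two_mul_notMem h2p
  have hT : Tendsto (fun z ↦ (z - p) * (L.weierstrassZeta (z + p) - L.weierstrassZeta (z - p)
      - 2 * L.weierstrassZeta p)) (𝓝[≠] p) (𝓝 (-1)) := by
    have hc : ContinuousAt (fun z ↦ (z - p) * (L.weierstrassZeta (z + p) - L.zetaRegular (z - p)
        - 2 * L.weierstrassZeta p) - 1) p := by
      have h1 : HasDerivAt L.weierstrassZeta _ (p + p) :=
        L.hasDerivAt_weierstrassZeta (by simpa [two_mul] using h2p)
      have h2 : HasDerivAt L.zetaRegular _ (p - p) :=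
        L.hasDerivAt_zetaRegular (by simp)
      exact ((((hasDerivAt_id p).sub_const p).mul
        (((h1.comp_add_const p p).sub (h2.comp_sub_const p p)).sub_const _)).sub_const
          1).continuousAt
    have h := hc.tendsto.mono_left (nhdsWithin_le_nhds (s := {p}ᶜ))
    simp only [sub_self, zero_mul, zero_sub] at h
    refine h.congr' ?_
    filter_upwards [self_mem_nhdsWithin] with z hz
    have hz : z - p ≠ 0 := sub_ne_zero.mpr hz
    rw [weierstrassZeta.eq_def L (z - p)]
    field_simp
    ring
  have hconst : ∀ᶠ z in 𝓝[≠] p, ℘[L] z = ℘[L] p := by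
    filter_upwards [hT.eventually_ne (neg_ne_zero.mpr one_ne_zero),
      L.eventually_punctured_isRegularFor p p] with z h1 h2
    have h := L.additionDefect_eq_zero hp h2p h2
    rw [additionDefect, hb, add_zero] at h
    exact sub_eq_zero.mp ((mul_eq_zero.mp h).resolve_left (right_ne_zero_of_mul h1))
  have heq : Set.EqOn ℘[L] (fun _ ↦ ℘[L] p) (L.lattice : Set ℂ)ᶜ :=
    L.analyticOnNhd_weierstrassP.eqOn_of_preconnected_of_frequently_eq analyticOnNhd_const
      L.isPreconnected_compl_lattice hp hconst.frequently
  have hord := L.order_weierstrassP 0 (zero_mem _)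
  rw [meromorphicOrderAt_congr (f₂ := fun _ ↦ ℘[L] p)
    ((L.eventually_punctured_notMem_lattice 0).mono fun z hz ↦ heq hz)] at hord
  have hnn := (analyticAt_const (𝕜 := ℂ) (v := ℘[L] p) (x := (0 : ℂ))).meromorphicOrderAt_nonneg
  rw [hord] at hnn
  exact absurd hnn (by decide)

lemma weierstrassP_sub_ne_zero {p z : ℂ} (h2p : 2 * p ∉ L.lattice) (hz : L.IsRegularFor p z) :
    ℘[L] z - ℘[L] p ≠ 0 := by
  intro h
  have hd := L.additionDefect_eq_zero (L.notMem_of_two_mul_notMem h2p) h2p hz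
  rw [additionDefect, h, mul_zero, zero_add] at hd
  exact L.derivWeierstrassP_ne_zero h2p hd

/-- A form of the addition theorem for the Weierstrass `ζ` function. -/
lemma weierstrassZeta_add_sub_weierstrassZeta_sub {p z : ℂ} (h2p : 2 * p ∉ L.lattice)
    (hz : L.IsRegularFor p z) :
    L.weierstrassZeta (z + p) - L.weierstrassZeta (z - p) =
      2 * L.weierstrassZeta p - ℘'[L] p / (℘[L] z - ℘[L] p) := by
  have hd := L.additionDefect_eq_zero (L.notMem_of_two_mul_notMem h2p) h2p hz
  have hw := L.weierstrassP_sub_ne_zero h2p hz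
  rw [additionDefect] at hd
  field_simp
  linear_combination hd

lemma deriv_derivWeierstrassP {z : ℂ} (hz : z ∉ L.lattice) :
    deriv ℘'[L] z = 6 * ℘[L] z ^ 2 - L.g₂ / 2 := by
  have hgen {w : ℂ} (hw : 2 * w ∉ L.lattice) : deriv ℘'[L] w = 6 * ℘[L] w ^ 2 - L.g₂ / 2 := by
    have hwL := L.notMem_of_two_mul_notMem hw
    have hx := L.hasDerivAt_weierstrassP hwL
    have h1 := (L.hasDerivAt_derivWeierstrassP hwL).fun_pow 2
    have h2 := (((hx.fun_pow 3).const_mul 4).fun_sub (hx.const_mul L.g₂)).sub_const L.g₃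
    have heq : (fun z ↦ ℘'[L] z ^ 2) =ᶠ[𝓝 w]
        fun z ↦ 4 * ℘[L] z ^ 3 - L.g₂ * ℘[L] z - L.g₃ := by
      filter_upwards [L.isClosed_lattice.isOpen_compl.mem_nhds hwL] with z hz
      exact L.derivWeierstrassP_sq z hz
    have h := h1.unique (h2.congr_of_eventuallyEq heq)
    simp only [Nat.cast_ofNat, Nat.add_one_sub_one, pow_one] at h
    refine mul_left_cancel₀ (L.derivWeierstrassP_ne_zero hw) ?_
    linear_combination h / 2
  have hn : Tendsto (fun w : ℂ ↦ 2 * w) (𝓝[≠] z) (𝓝[≠] (2 * z)) := by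
    refine tendsto_nhdsWithin_of_tendsto_nhds_of_eventually_within _
      ((continuous_const_mul (2 : ℂ)).tendsto z |>.mono_left nhdsWithin_le_nhds) ?_
    filter_upwards [self_mem_nhdsWithin] with w hw
    simpa using hw
  have hev : deriv ℘'[L] =ᶠ[𝓝[≠] z] fun w ↦ 6 * ℘[L] w ^ 2 - L.g₂ / 2 :=
    (hn.eventually (L.eventually_punctured_notMem_lattice (2 * z))).mono fun _ ↦ hgen
  have hc1 : ContinuousAt (deriv ℘'[L]) z :=
    (L.analyticOnNhd_derivWeierstrassP z hz).deriv.continuousAt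
  have hc2 : ContinuousAt (fun w ↦ 6 * ℘[L] w ^ 2 - L.g₂ / 2) z := by
    have := (L.analyticOnNhd_weierstrassP z hz).continuousAt
    fun_prop
  exact ((hc1.eventuallyEq_nhds_iff_eventuallyEq_nhdsNE hc2).mp hev).eq_of_nhds

lemma hasDerivAt_deriv_derivWeierstrassP {z : ℂ} (hz : z ∉ L.lattice) :
    HasDerivAt (deriv ℘'[L]) (12 * ℘[L] z * ℘'[L] z) z := by
  have h := (((L.hasDerivAt_weierstrassP hz).fun_pow 2).const_mul 6).sub_const (L.g₂ / 2)
  convert! h.congr_of_eventuallyEq ((eventually_of_mem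
    (L.isClosed_lattice.isOpen_compl.mem_nhds hz) fun w hw ↦ L.deriv_derivWeierstrassP hw)) using 1
  simp
  ring

/-- The expansion of `℘'(z) ^ 2` in powers of `℘(z) - ℘(p)`. -/
lemma derivWeierstrassP_sq_eq {p z : ℂ} (hp : p ∉ L.lattice) (hz : z ∉ L.lattice) :
    ℘'[L] z ^ 2 = ℘'[L] p ^ 2 + 2 * deriv ℘'[L] p * (℘[L] z - ℘[L] p) +
      12 * ℘[L] p * (℘[L] z - ℘[L] p) ^ 2 + 4 * (℘[L] z - ℘[L] p) ^ 3 := by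
  rw [L.derivWeierstrassP_sq z hz, L.derivWeierstrassP_sq p hp, L.deriv_derivWeierstrassP hp]
  ring

lemma eventually_two_mul_notMem_lattice {p : ℂ} (h2p : 2 * p ∉ L.lattice) :
    ∀ᶠ u in 𝓝 p, 2 * u ∉ L.lattice :=
  (continuous_const_mul (2 : ℂ)).continuousAt.eventually
    (L.isClosed_lattice.isOpen_compl.mem_nhds h2p)

lemma weierstrassP_add_add_weierstrassP_sub {p z : ℂ} (h2p : 2 * p ∉ L.lattice)
    (hz : L.IsRegularFor p z) :
    ℘[L] (z + p) + ℘[L] (z - p) = 2 * ℘[L] p + deriv ℘'[L] p / (℘[L] z - ℘[L] p) +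
      ℘'[L] p ^ 2 / (℘[L] z - ℘[L] p) ^ 2 := by
  have hp := L.notMem_of_two_mul_notMem h2p
  have hw := L.weierstrassP_sub_ne_zero h2p hz
  have h1 := ((L.hasDerivAt_weierstrassZeta hz.2.2).comp_const_add z p).fun_sub
    ((L.hasDerivAt_weierstrassZeta hz.2.1).comp_const_sub z p)
  have h2 := ((L.hasDerivAt_weierstrassZeta hp).const_mul 2).fun_sub
    ((L.hasDerivAt_derivWeierstrassP hp).fun_div
      ((L.hasDerivAt_weierstrassP hp).const_sub (℘[L] z)) hw)
  have heq : (fun u ↦ L.weierstrassZeta (z + u) - L.weierstrassZeta (z - u)) =ᶠ[𝓝 p]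
      fun u ↦ 2 * L.weierstrassZeta u - ℘'[L] u / (℘[L] z - ℘[L] u) := by
    have e1 : ∀ᶠ u in 𝓝 p, z + u ∉ L.lattice := (continuous_const_add z).continuousAt.eventually
      (L.isClosed_lattice.isOpen_compl.mem_nhds hz.2.2)
    have e2 : ∀ᶠ u in 𝓝 p, z - u ∉ L.lattice := (continuous_sub_left z).continuousAt.eventually
      (L.isClosed_lattice.isOpen_compl.mem_nhds hz.2.1)
    filter_upwards [e1, e2, L.eventually_two_mul_notMem_lattice h2p] with u hu1 hu2 hu3
    exact L.weierstrassZeta_add_sub_weierstrassZeta_sub hu3 ⟨hz.1, hu2, hu1⟩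
  have h := h1.unique (h2.congr_of_eventuallyEq heq)
  field_simp at h ⊢
  linear_combination -h

/-- The duplication formula for the Weierstrass `ζ` function. -/
lemma weierstrassZeta_two_mul {p : ℂ} (h2p : 2 * p ∉ L.lattice) :
    L.weierstrassZeta (2 * p) = 2 * L.weierstrassZeta p + deriv ℘'[L] p / (2 * ℘'[L] p) := by
  have hp := L.notMem_of_two_mul_notMem h2p
  have hb := L.derivWeierstrassP_ne_zero h2p
  have hx : HasDerivAt ℘[L] (℘'[L] p) (0 + p) := by simpa using L.hasDerivAt_weierstrassP hp
  have hT : Tendsto (fun t ↦ (℘[L] (t + p) - ℘[L] p - ℘'[L] p * t) / t ^ 2) (𝓝[≠] 0)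
      (𝓝 (deriv ℘'[L] p / 2)) := by
    refine tendsto_div_sq_of_deriv_eq_zero (f' := fun t ↦ ℘'[L] (t + p) - ℘'[L] p) ?_ ?_ ?_ ?_
    · filter_upwards [L.eventually_add_notMem_lattice (z := 0) (c := p) (by simpa using hp)]
        with t ht
      simpa using! (((L.hasDerivAt_weierstrassP ht).comp_add_const t p).sub_const (℘[L] p)).fun_sub
        ((hasDerivAt_id t).const_mul (℘'[L] p))
    · have hy : HasDerivAt ℘'[L] (deriv ℘'[L] p) (0 + p) := by
        simpa using L.hasDerivAt_derivWeierstrassP hp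
      exact (hy.comp_add_const 0 p).sub_const _
    · simp
    · simp
  have hs : Tendsto (fun t ↦ (℘[L] (t + p) - ℘[L] p) / t) (𝓝[≠] 0) (𝓝 (℘'[L] p)) := by
    refine (hasDerivAt_iff_tendsto_slope.mp (hx.comp_add_const 0 p)).congr fun z ↦ ?_
    simp [slope_def_field]
  have hm : Tendsto (fun t ↦ L.weierstrassZeta (t + 2 * p) - L.zetaRegular t
      - 2 * L.weierstrassZeta p) (𝓝[≠] 0)
      (𝓝 (L.weierstrassZeta (2 * p) - 2 * L.weierstrassZeta p)) := by
    have h1 : HasDerivAt L.weierstrassZeta _ (0 + 2 * p) :=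
      L.hasDerivAt_weierstrassZeta (by simpa using h2p)
    have h2 : HasDerivAt L.zetaRegular _ 0 := L.hasDerivAt_zetaRegular (by simp)
    have hc := (((h1.comp_add_const 0 (2 * p)).fun_sub h2).sub_const
      (2 * L.weierstrassZeta p)).continuousAt
    simpa using hc.tendsto.mono_left (nhdsWithin_le_nhds (s := {0}ᶜ))
  have hreg : ∀ᶠ t in 𝓝[≠] (0 : ℂ), L.IsRegularFor p (t + p) := by
    filter_upwards [L.eventually_punctured_notMem_lattice 0,
      L.eventually_punctured_add_notMem_lattice 0 p,
      L.eventually_punctured_add_notMem_lattice 0 (2 * p)] with t h0 h1 h2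
    exact ⟨h1, by simpa using h0, by rwa [add_assoc, ← two_mul]⟩
  have h := tendsto_nhds_unique_of_eventuallyEq (hm.mul hs) hT (by
    filter_upwards [hreg, self_mem_nhdsWithin] with t ht ht0
    have ht0 : t ≠ 0 := ht0
    have hd := L.additionDefect_eq_zero hp h2p ht
    rw [additionDefect, add_sub_cancel_right, add_assoc, ← two_mul, weierstrassZeta.eq_def L t]
      at hd
    field_simp at hd ⊢
    linear_combination hd)
  field_simp at h ⊢
  linear_combination h

/-- The duplication formula for the Weierstrass `℘` function. -/
lemma weierstrassP_two_mul {p : ℂ} (h2p : 2 * p ∉ L.lattice) :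
    ℘[L] (2 * p) = -2 * ℘[L] p + (deriv ℘'[L] p / ℘'[L] p) ^ 2 / 4 := by
  have hp := L.notMem_of_two_mul_notMem h2p
  have hb := L.derivWeierstrassP_ne_zero h2p
  have h1 := (L.hasDerivAt_weierstrassZeta h2p).comp p ((hasDerivAt_id p).const_mul 2)
  have h2 := ((L.hasDerivAt_weierstrassZeta hp).const_mul 2).fun_add
    ((L.hasDerivAt_deriv_derivWeierstrassP hp).fun_div
      ((L.hasDerivAt_derivWeierstrassP hp).const_mul 2) (mul_ne_zero two_ne_zero hb))
  have h := h1.unique (h2.congr_of_eventuallyEq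
    ((L.eventually_two_mul_notMem_lattice h2p).mono fun _ ↦ L.weierstrassZeta_two_mul))
  field_simp at h ⊢
  linear_combination -h

end PeriodPair

/-- The period pair `(1, τ)`. -/
def upperHalfPeriodPair (τ : ℂ) (hτ : 0 < τ.im) : PeriodPair where
  ω₁ := 1
  ω₂ := τ
  indep := by
    refine LinearIndependent.pair_iff.mpr fun s t h ↦ ?_
    have him := congr_arg Complex.im h
    have hre := congr_arg Complex.re h
    have ht : t = 0 := by simpa [hτ.ne'] using him
    exact ⟨by simpa [ht] using hre, ht⟩

lemma mem_Lam_iff {τ : ℂ} (hτ : 0 < τ.im) {z : ℂ} :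
    z ∈ Lam τ ↔ z ∈ (upperHalfPeriodPair τ hτ).lattice := by
  simp [Lam, PeriodPair.mem_lattice, upperHalfPeriodPair, eq_comm]

lemma tsum_Lam' {τ : ℂ} (hτ : 0 < τ.im) (f : ℂ → ℂ) :
    ∑' ω : Lam' τ, f ω =
      ∑' l : (upperHalfPeriodPair τ hτ).lattice, if l.1 = 0 then 0 else f l := by
  set L := upperHalfPeriodPair τ hτ
  classical
  have h1 : ∑' ω : Lam' τ, f ω = ∑' z : ℂ, (Lam' τ).indicator f z := tsum_subtype _ _
  have h2 : ∑' l : L.lattice, (if l.1 = 0 then 0 else f l) =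
      ∑' z : ℂ, (L.lattice : Set ℂ).indicator (fun z ↦ if z = 0 then 0 else f z) z :=
    tsum_subtype (L.lattice : Set ℂ) (fun z ↦ if z = 0 then 0 else f z)
  rw [h1, h2]
  congr 1 with z
  have hz := mem_Lam_iff hτ (z := z)
  by_cases hz0 : z = 0 <;> by_cases hzL : z ∈ L.lattice <;>
    simp_all [Lam', Set.indicator, L]

open PeriodPair in
lemma wp_eq_weierstrassP {τ : ℂ} (hτ : 0 < τ.im) :
    wp τ = ℘[upperHalfPeriodPair τ hτ] := by
  ext z
  have h := (upperHalfPeriodPair τ hτ).weierstrassPExcept_add 0 z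
  simp only [ZeroMemClass.coe_zero, sub_zero, ne_eq, OfNat.ofNat_ne_zero, not_false_eq_true,
    zero_pow, div_zero] at h
  rw [wp, tsum_Lam' hτ fun ω ↦ 1 / (z - ω) ^ 2 - 1 / ω ^ 2, ← h, add_comm, weierstrassPExcept]

lemma wzeta_eq_weierstrassZeta {τ : ℂ} (hτ : 0 < τ.im) :
    wzeta τ = (upperHalfPeriodPair τ hτ).weierstrassZeta := by
  ext z
  rw [wzeta, tsum_Lam' hτ fun ω ↦ 1 / (z - ω) + 1 / ω + z / ω ^ 2, PeriodPair.weierstrassZeta,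
    PeriodPair.zetaRegular]

lemma notMem_Sset_iff {τ : ℂ} (hτ : 0 < τ.im) {p z : ℂ} :
    z ∉ Sset τ p ↔ (upperHalfPeriodPair τ hτ).IsRegularFor p z := by
  simp only [Sset, PeriodPair.IsRegularFor, Set.mem_union, Set.mem_ofPred_eq, not_or,
    mem_Lam_iff hτ, and_assoc]

open PeriodPair in
lemma Phie_eq {τ p z : ℂ} (hτ : 0 < τ.im) (hp : 2 * p ∉ Lam τ) (A : ℂ) (hz : z ∉ Sset τ p) :
    Phie τ p A z = (wp τ z - wp τ p)
      - (A / 2 - 3 / 8 * (wpdd τ p / wpd τ p)) * wpd τ p / (wp τ z - wp τ p)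
      - A ^ 2 + wpdd τ p / wpd τ p * A / 2 + 3 / 16 * (wpdd τ p / wpd τ p) ^ 2 := by
  rw [mem_Lam_iff hτ] at hp
  rw [notMem_Sset_iff hτ] at hz
  rw [Phie, wzeta_eq_weierstrassZeta hτ,
    weierstrassZeta_add_sub_weierstrassZeta_sub _ hp hz, wpd, wpdd, wp_eq_weierstrassP hτ,
    deriv_weierstrassP]
  have hb := derivWeierstrassP_ne_zero _ hp
  have hw := weierstrassP_sub_ne_zero _ hp hz
  field_simp
  ring

open PeriodPair in
lemma qpot_eq {τ p z : ℂ} (hτ : 0 < τ.im) (hp : 2 * p ∉ Lam τ) (A : ℂ) (hz : z ∉ Sset τ p) :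
    qpot τ p A z = 2 * wp τ z
      + 3 / 4 * (2 * wp τ p + wpdd τ p / (wp τ z - wp τ p)
        + wpd τ p ^ 2 / (wp τ z - wp τ p) ^ 2)
      - A * wpd τ p / (wp τ z - wp τ p) + A ^ 2 - wpdd τ p / wpd τ p * A / 2
      - 3 / 4 * (-2 * wp τ p + (wpdd τ p / wpd τ p) ^ 2 / 4) - 2 * wp τ p := by
  rw [mem_Lam_iff hτ] at hp
  rw [notMem_Sset_iff hτ] at hz
  rw [qpot, Bc, wzeta_eq_weierstrassZeta hτ, weierstrassZeta_two_mul _ hp,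
    weierstrassZeta_add_sub_weierstrassZeta_sub _ hp hz, wpd, wpdd, wp_eq_weierstrassP hτ,
    deriv_weierstrassP, weierstrassP_two_mul _ hp, weierstrassP_add_add_weierstrassP_sub _ hp hz]
  have hb := derivWeierstrassP_ne_zero _ hp
  have hw := weierstrassP_sub_ne_zero _ hp hz
  field_simp
  ring

/-- The algebraic identity behind the third-order equation: `w = ℘(z) - ℘(p)`, `y = ℘'(z)`,
`a = ℘(p)`, `b = ℘'(p)` and `c = ℘''(p) / ℘'(p)`. -/
lemma second_symmetric_power_identity {a b c w A y : ℂ} (hw : w ≠ 0)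
    (hy : y ^ 2 = b ^ 2 + 2 * (c * b) * w + 12 * a * w ^ 2 + 4 * w ^ 3) :
    12 * (a + w) * y * (1 + (A / 2 - 3 / 8 * c) * b / w ^ 2)
        - 6 * (A / 2 - 3 / 8 * c) * b * y * (c * b + 12 * a * w + 6 * w ^ 2) / w ^ 3
        + 6 * (A / 2 - 3 / 8 * c) * b * y ^ 3 / w ^ 4
      - 4 * (2 * (w + a) + 3 / 4 * (2 * a + c * b / w + b ^ 2 / w ^ 2) - A * b / w + A ^ 2
          - c * A / 2 - 3 / 4 * (-2 * a + c ^ 2 / 4) - 2 * a)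
        * (y * (1 + (A / 2 - 3 / 8 * c) * b / w ^ 2))
      - 2 * (2 * y + 3 / 4 * (-c * b * y / w ^ 2 - 2 * b ^ 2 * y / w ^ 3) + A * b * y / w ^ 2)
        * (w - (A / 2 - 3 / 8 * c) * b / w - A ^ 2 + c * A / 2 + 3 / 16 * c ^ 2) = 0 := by
  have hy3 : y ^ 3 = y * (b ^ 2 + 2 * (c * b) * w + 12 * a * w ^ 2 + 4 * w ^ 3) := by
    rw [← hy]
    ring
  rw [hy3]
  field_simp
  ring

open PeriodPair in
/-- `Φ_e(·; A)` satisfies the third-order ODE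
`Φ''' − 4q Φ' − 2q' Φ = 0` on `ℂ ∖ S`. -/
theorem stmt_0 (τ p : ℂ) (hτ : 0 < τ.im) (hp : 2 * p ∉ Lam τ)
    (A : ℂ) (z : ℂ) (hz : z ∉ Sset τ p) :
    deriv (deriv (deriv (Phie τ p A))) z
      - 4 * qpot τ p A z * deriv (Phie τ p A) z
      - 2 * deriv (qpot τ p A) z * Phie τ p A z = 0 := by
  set L := upperHalfPeriodPair τ hτ
  have hpL : 2 * p ∉ L.lattice := by rwa [← mem_Lam_iff hτ]
  have hp1 := L.notMem_of_two_mul_notMem hpL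
  have hP : wp τ = ℘[L] := wp_eq_weierstrassP hτ
  have hreg : L.IsRegularFor p z := (notMem_Sset_iff hτ).mp hz
  have hnhds {u : ℂ} (hu : L.IsRegularFor p u) : ∀ᶠ v in 𝓝 u, L.IsRegularFor p v := hu.eventually
  have hwd : wpd τ p = ℘'[L] p := by rw [wpd, hP, deriv_weierstrassP]
  have hwdd : wpdd τ p = deriv ℘'[L] p := by rw [wpdd, hP, deriv_weierstrassP]
  set a := ℘[L] p
  set b := ℘'[L] p
  have hb0 : b ≠ 0 := L.derivWeierstrassP_ne_zero hpL
  set c := deriv ℘'[L] p / b with hc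
  have hcb : deriv ℘'[L] p = c * b := by rw [hc, div_mul_cancel₀ _ hb0]
  set α := A / 2 - 3 / 8 * c
  have hw0 {u : ℂ} (hu : L.IsRegularFor p u) : ℘[L] u - a ≠ 0 :=
    L.weierstrassP_sub_ne_zero hpL hu
  have hw {u : ℂ} (hu : L.IsRegularFor p u) : HasDerivAt (fun u ↦ ℘[L] u - a) (℘'[L] u) u :=
    (L.hasDerivAt_weierstrassP hu.1).sub_const a
  have hy {u : ℂ} (hu : L.IsRegularFor p u) :
      HasDerivAt ℘'[L] (c * b + 12 * a * (℘[L] u - a) + 6 * (℘[L] u - a) ^ 2) u := by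
    convert! L.hasDerivAt_derivWeierstrassP hu.1 using 1
    have := L.deriv_derivWeierstrassP hp1
    rw [L.deriv_derivWeierstrassP hu.1, ← hcb, this]
    ring
  have hy2 : ℘'[L] z ^ 2 = b ^ 2 + 2 * (c * b) * (℘[L] z - a) + 12 * a * (℘[L] z - a) ^ 2
      + 4 * (℘[L] z - a) ^ 3 := by
    rw [L.derivWeierstrassP_sq_eq hp1 hreg.1, ← hcb]
  have hΦ {u : ℂ} (hu : L.IsRegularFor p u) : Phie τ p A u =
      (℘[L] u - a) - α * b / (℘[L] u - a) - A ^ 2 + c * A / 2 + 3 / 16 * c ^ 2 := by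
    rw [Phie_eq hτ hp A ((notMem_Sset_iff hτ).mpr hu), hP, hwd, hwdd]
  have hq {u : ℂ} (hu : L.IsRegularFor p u) : qpot τ p A u =
      2 * (℘[L] u - a + a) + 3 / 4 * (2 * a + c * b / (℘[L] u - a) + b ^ 2 / (℘[L] u - a) ^ 2)
        - A * b / (℘[L] u - a) + A ^ 2 - c * A / 2 - 3 / 4 * (-2 * a + c ^ 2 / 4) - 2 * a := by
    rw [qpot_eq hτ hp A ((notMem_Sset_iff hτ).mpr hu), hP, hwd, hwdd, ← hcb, sub_add_cancel]
  have hΦ1 {u : ℂ} (hu : L.IsRegularFor p u) : deriv (Phie τ p A) u =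
      ℘'[L] u * (1 + α * b / (℘[L] u - a) ^ 2) := by
    rw [EventuallyEq.deriv_eq ((hnhds hu).mono fun v hv ↦ hΦ hv)]
    have h := (((((hw hu).fun_sub ((hasDerivAt_const u (α * b)).fun_div (hw hu) (hw0 hu))).sub_const
      (A ^ 2)).add_const (c * A / 2)).add_const (3 / 16 * c ^ 2)).deriv
    rw [h]
    ring
  have hΦ2 {u : ℂ} (hu : L.IsRegularFor p u) : deriv (deriv (Phie τ p A)) u =
      (c * b + 12 * a * (℘[L] u - a) + 6 * (℘[L] u - a) ^ 2) * (1 + α * b / (℘[L] u - a) ^ 2)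
        - 2 * α * b * ℘'[L] u ^ 2 / (℘[L] u - a) ^ 3 := by
    rw [EventuallyEq.deriv_eq ((hnhds hu).mono fun v hv ↦ hΦ1 hv)]
    have h := ((hy hu).fun_mul (((hasDerivAt_const u (α * b)).fun_div ((hw hu).fun_pow 2)
      (pow_ne_zero 2 (hw0 hu))).const_add 1)).deriv
    rw [h]
    have := hw0 hu
    field_simp
    ring
  have hΦ3 : deriv (deriv (deriv (Phie τ p A))) z =
      12 * (a + (℘[L] z - a)) * ℘'[L] z * (1 + α * b / (℘[L] z - a) ^ 2)
        - 6 * α * b * ℘'[L] z * (c * b + 12 * a * (℘[L] z - a) + 6 * (℘[L] z - a) ^ 2)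
          / (℘[L] z - a) ^ 3
        + 6 * α * b * ℘'[L] z ^ 3 / (℘[L] z - a) ^ 4 := by
    rw [EventuallyEq.deriv_eq ((hnhds hreg).mono fun v hv ↦ hΦ2 hv)]
    have h1 := (((hw hreg).const_mul (12 * a)).const_add (c * b)).fun_add
      (((hw hreg).fun_pow 2).const_mul 6)
    have h2 := ((hasDerivAt_const z (α * b)).fun_div ((hw hreg).fun_pow 2)
      (pow_ne_zero 2 (hw0 hreg))).const_add 1
    have h3 := (((hy hreg).fun_pow 2).const_mul (2 * α * b)).fun_div ((hw hreg).fun_pow 3)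
      (pow_ne_zero 3 (hw0 hreg))
    rw [((h1.fun_mul h2).fun_sub h3).deriv]
    have := hw0 hreg
    field_simp
    ring
  have hq1 : deriv (qpot τ p A) z = 2 * ℘'[L] z + 3 / 4 * (-c * b * ℘'[L] z / (℘[L] z - a) ^ 2
      - 2 * b ^ 2 * ℘'[L] z / (℘[L] z - a) ^ 3) + A * b * ℘'[L] z / (℘[L] z - a) ^ 2 := by
    rw [EventuallyEq.deriv_eq ((hnhds hreg).mono fun v hv ↦ hq hv)]
    have h1 := ((hw hreg).add_const a).const_mul 2
    have h2 := (hasDerivAt_const z (c * b)).fun_div (hw hreg) (hw0 hreg)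
    have h3 := (hasDerivAt_const z (b ^ 2)).fun_div ((hw hreg).fun_pow 2)
      (pow_ne_zero 2 (hw0 hreg))
    have h4 := (hasDerivAt_const z (A * b)).fun_div (hw hreg) (hw0 hreg)
    rw [((((((h1.fun_add (((h2.const_add (2 * a)).fun_add h3).const_mul (3 / 4))).fun_sub
      h4).add_const (A ^ 2)).sub_const (c * A / 2)).sub_const
        (3 / 4 * (-2 * a + c ^ 2 / 4))).sub_const (2 * a)).deriv]
    have := hw0 hreg
    field_simp
    ring
  rw [hΦ3, hq hreg, hΦ1 hreg, hq1, hΦ hreg]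
  exact second_symmetric_power_identity (hw0 hreg) hy2
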